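/- The complex vector space {ψ ∈ L²(ℝ₊ × ℝ, r dr dθ) : Δψ = ψ distributionally} is infinite-dimensional. Consequently, the operator Δ with domain C_c^∞(ℝ₊ × ℝ) in L²(ℝ₊ × ℝ, r dr dθ) (the Laplacian of the Riemann surface of log z) is not essentially selfadjoint, and has deficiency indices (∞, ∞). -/

import Mathlib

open MeasureTheory Set

/-- The measure `r dr dθ` on `ℝ₊ × ℝ` (polar coordinates model of the Riemann
surface of `log z`). -/
noncomputable def polarMeasure : Measure (ℝ × ℝ) :=
  ((volume : Measure (ℝ × ℝ)).restrict (Set.Ioi (0:ℝ) ×ˢ Set.univ)).withDensity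
    fun p => ENNReal.ofReal p.1

/-- `C_c^∞(ℝ₊ × ℝ)`: smooth compactly supported functions with support in `ℝ₊ × ℝ`. -/
def IsLogTest (f : ℝ × ℝ → ℂ) : Prop :=
  ContDiff ℝ (⊤ : ℕ∞) f ∧ HasCompactSupport f ∧ tsupport f ⊆ Set.Ioi (0:ℝ) ×ˢ Set.univ

/-- `∂/∂r`. -/
noncomputable def pdr (f : ℝ × ℝ → ℂ) (p : ℝ × ℝ) : ℂ := fderiv ℝ f p (1, 0)

/-- `∂/∂θ`. -/
noncomputable def pdθ (f : ℝ × ℝ → ℂ) (p : ℝ × ℝ) : ℂ := fderiv ℝ f p (0, 1)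

/-- The polar-coordinate Laplacian `Δφ = ∂²φ/∂r² + (1/r)∂φ/∂r + (1/r²)∂²φ/∂θ²`. -/
noncomputable def polarLap (f : ℝ × ℝ → ℂ) (p : ℝ × ℝ) : ℂ :=
  pdr (pdr f) p + (1 / (p.1 : ℂ)) * pdr f p + (1 / (p.1 : ℂ) ^ 2) * pdθ (pdθ f) p

/-- `ψ` is a distributional solution of `Δψ = c ψ` on the log-surface. -/
noncomputable def IsDistribEigen (c : ℂ) (ψ : Lp ℂ 2 polarMeasure) : Prop :=
  ∀ φ : ℝ × ℝ → ℂ, IsLogTest φ →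
    ∫ p, ψ p * (starRingEnd ℂ) (polarLap φ p - c * φ p) ∂polarMeasure = 0

/-! ### The polar measure -/

instance : SFinite polarMeasure := by unfold polarMeasure; infer_instance

instance : IsLocallyFiniteMeasure polarMeasure :=
  IsLocallyFiniteMeasure.withDensity_ofReal continuous_fst

theorem isOpen_halfPlane : IsOpen (Ioi (0 : ℝ) ×ˢ (univ : Set ℝ)) := isOpen_Ioi.prod isOpen_univ

theorem measurableSet_halfPlane : MeasurableSet (Ioi (0 : ℝ) ×ˢ (univ : Set ℝ)) :=
  isOpen_halfPlane.measurableSet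

theorem ae_polarMeasure_iff {P : ℝ × ℝ → Prop} :
    (∀ᵐ p ∂polarMeasure, P p) ↔
      ∀ᵐ p ∂(volume : Measure (ℝ × ℝ)).restrict (Ioi (0 : ℝ) ×ˢ univ), P p := by
  rw [polarMeasure, ae_withDensity_iff (by fun_prop)]
  constructor
  · intro h
    filter_upwards [h, ae_restrict_mem measurableSet_halfPlane] with p hp hp'
    exact hp (by simpa using hp'.1)
  · intro h
    filter_upwards [h] with p hp _ using hp

theorem ae_polarMeasure_pos : ∀ᵐ p ∂polarMeasure, 0 < p.1 :=
  ae_polarMeasure_iff.2 <| (ae_restrict_mem measurableSet_halfPlane).mono fun _ hp => hp.1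

theorem integral_polarMeasure {g : ℝ × ℝ → ℂ} (hg : ∀ p : ℝ × ℝ, p.1 ≤ 0 → g p = 0) :
    ∫ p, g p ∂polarMeasure = ∫ p : ℝ × ℝ, (p.1 : ℂ) * g p := by
  have h0 : ∀ p : ℝ × ℝ, p ∉ Ioi (0 : ℝ) ×ˢ univ → (p.1 : ℂ) * g p = 0 := fun p hp => by
    rw [hg p (by simpa using hp), mul_zero]
  rw [polarMeasure, integral_withDensity_eq_integral_toReal_smul (by fun_prop) (by simp),
    ← setIntegral_eq_integral_of_forall_compl_eq_zero h0]
  refine setIntegral_congr_fun measurableSet_halfPlane fun p hp => ?_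
  simp [ENNReal.toReal_ofReal (le_of_lt hp.1)]

theorem integrable_polarMeasure_iff {g : ℝ × ℝ → ℝ} :
    Integrable g polarMeasure ↔
      Integrable (fun p : ℝ × ℝ => p.1 * g p)
        ((volume : Measure (ℝ × ℝ)).restrict (Ioi (0 : ℝ) ×ˢ univ)) := by
  rw [polarMeasure, integrable_withDensity_iff_integrable_smul' (by fun_prop) (by simp)]
  refine integrable_congr ((ae_restrict_mem measurableSet_halfPlane).mono fun p hp => ?_)
  simp [ENNReal.toReal_ofReal (le_of_lt hp.1)]

theorem ContinuousOn.aestronglyMeasurable_polarMeasure {f : ℝ × ℝ → ℂ}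
    (hf : ContinuousOn f (Ioi (0 : ℝ) ×ˢ univ)) : AEStronglyMeasurable f polarMeasure :=
  (hf.aestronglyMeasurable measurableSet_halfPlane).mono_ac (withDensity_absolutelyContinuous _ _)

theorem eq_zero_of_ae_polarMeasure {f : ℝ × ℝ → ℂ}
    (hf : ContinuousOn f (Ioi (0 : ℝ) ×ˢ univ)) (h : ∀ᵐ p ∂polarMeasure, f p = 0)
    {p : ℝ × ℝ} (hp : 0 < p.1) : f p = 0 :=
  Measure.eqOn_open_of_ae_eq (g := fun _ => 0) (ae_polarMeasure_iff.1 h) isOpen_halfPlane hf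
    continuousOn_const (x := p) ⟨hp, mem_univ _⟩

/-! ### Test functions -/

namespace IsLogTest

variable {f g : ℝ × ℝ → ℂ}

theorem eq_zero (hf : IsLogTest f) {p : ℝ × ℝ} (hp : p.1 ≤ 0) : f p = 0 := by
  by_contra h
  exact absurd (hf.2.2 (subset_tsupport f h)).1 (not_lt.2 hp)

theorem add (hf : IsLogTest f) (hg : IsLogTest g) : IsLogTest (fun p => f p + g p) :=
  ⟨hf.1.add hg.1, hf.2.1.add hg.2.1,
    (tsupport_add f g).trans (union_subset hf.2.2 hg.2.2)⟩

theorem const_mul (hf : IsLogTest f) (c : ℂ) : IsLogTest (fun p => c * f p) :=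
  ⟨contDiff_const.mul hf.1, hf.2.1.mul_left,
    (tsupport_mul_subset_right (f := fun _ => c) (g := f)).trans hf.2.2⟩

theorem sub (hf : IsLogTest f) (hg : IsLogTest g) : IsLogTest (fun p => f p - g p) := by
  simpa [sub_eq_add_neg] using hf.add (hg.const_mul (-1))

theorem conj (hf : IsLogTest f) : IsLogTest (fun p => (starRingEnd ℂ) (f p)) := by
  have h : tsupport (fun p => (starRingEnd ℂ) (f p)) ⊆ tsupport f :=
    closure_mono fun p hp h => hp (by simp [h])
  exact ⟨Complex.conjCLE.contDiff.comp hf.1, hf.2.1.comp_left (map_zero _), h.trans hf.2.2⟩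

theorem fderiv_apply (hf : IsLogTest f) (v : ℝ × ℝ) : IsLogTest (fun p => fderiv ℝ f p v) :=
  ⟨(hf.1.fderiv_right (m := (⊤ : ℕ∞)) (by simp)).clm_apply contDiff_const,
    hf.2.1.fderiv_apply (𝕜 := ℝ) v, (tsupport_fderiv_apply_subset ℝ v).trans hf.2.2⟩

theorem pdr (hf : IsLogTest f) : IsLogTest (pdr f) := hf.fderiv_apply _

theorem pdθ (hf : IsLogTest f) : IsLogTest (pdθ f) := hf.fderiv_apply _

theorem mul_of_contDiffOn {h : ℝ × ℝ → ℂ} (hf : IsLogTest f)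
    (hh : ContDiffOn ℝ (⊤ : ℕ∞) h (Ioi (0 : ℝ) ×ˢ univ)) : IsLogTest (fun p => h p * f p) := by
  refine ⟨contDiff_iff_contDiffAt.2 fun p => ?_, hf.2.1.mul_left,
    (tsupport_mul_subset_right (f := h) (g := f)).trans hf.2.2⟩
  by_cases hp : p ∈ tsupport f
  · exact (hh.contDiffAt (isOpen_halfPlane.mem_nhds (hf.2.2 hp))).mul hf.1.contDiffAt
  · refine (contDiffAt_const (c := (0 : ℂ))).congr_of_eventuallyEq ?_
    filter_upwards [notMem_tsupport_iff_eventuallyEq.1 hp] with q hq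
    simp [hq]

theorem inv_mul (hf : IsLogTest f) : IsLogTest (fun p => (1 / (p.1 : ℂ)) * f p) := by
  refine hf.mul_of_contDiffOn fun p hp => ContDiffAt.contDiffWithinAt ?_
  have h1 : ContDiffAt ℝ (⊤ : ℕ∞) (fun p : ℝ × ℝ => (p.1 : ℂ)) p :=
    (Complex.ofRealCLM.contDiff.comp contDiff_fst).contDiffAt
  have h0 : (p.1 : ℂ) ≠ 0 := by exact_mod_cast (ne_of_gt hp.1)
  simp only [one_div]
  exact h1.inv h0

theorem polarLap (hf : IsLogTest f) : IsLogTest (polarLap f) := by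
  have h := (hf.pdr.pdr.add hf.pdr.inv_mul).add hf.pdθ.pdθ.inv_mul.inv_mul
  convert h using 2 with p
  rw [_root_.polarLap]
  ring

theorem memLp (hf : IsLogTest f) : MemLp f 2 polarMeasure :=
  hf.1.continuous.memLp_of_hasCompactSupport hf.2.1

theorem integrable (hf : IsLogTest f) : Integrable f polarMeasure :=
  hf.1.continuous.integrable_of_hasCompactSupport hf.2.1

/-- The support of a test function stays away from `r = 0`. -/
theorem exists_pos_forall_le (hf : IsLogTest f) : ∃ ε > 0, ∀ p : ℝ × ℝ, p.1 < ε → f p = 0 := by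
  obtain h | h := (tsupport f).eq_empty_or_nonempty
  · exact ⟨1, one_pos, fun p _ => by
      by_contra hp
      simpa [h] using subset_tsupport f hp⟩
  · obtain ⟨q, hq, hmin⟩ := hf.2.1.exists_isMinOn h continuous_fst.continuousOn
    refine ⟨q.1, (hf.2.2 hq).1, fun p hp => ?_⟩
    by_contra h0
    exact absurd (hmin (subset_tsupport f h0)) (not_le.2 hp)

end IsLogTest

theorem polarLap_conj (f : ℝ × ℝ → ℂ) (p : ℝ × ℝ) :
    polarLap (fun q => (starRingEnd ℂ) (f q)) p = (starRingEnd ℂ) (polarLap f p) := by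
  have h (g : ℝ × ℝ → ℂ) (v : ℝ × ℝ) :
      (fun p => fderiv ℝ (fun q => (starRingEnd ℂ) (g q)) p v) =
        fun p => (starRingEnd ℂ) (fderiv ℝ g p v) := by
    ext p
    have := Complex.conjCLE.comp_fderiv (f := g) (x := p)
    exact congrArg (fun L : ℝ × ℝ →L[ℝ] ℂ => L v) this
  have hr (g : ℝ × ℝ → ℂ) : pdr (fun q => (starRingEnd ℂ) (g q)) =
      fun p => (starRingEnd ℂ) (pdr g p) := h g _
  have hθ (g : ℝ × ℝ → ℂ) : pdθ (fun q => (starRingEnd ℂ) (g q)) =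
      fun p => (starRingEnd ℂ) (pdθ g p) := h g _
  simp [polarLap, hr, hθ]

/-! ### Symmetry of the polar Laplacian -/

theorem integral_mul_fderiv_eq_neg {u φ : ℝ × ℝ → ℂ} (hu : ContDiff ℝ 1 u) (hφ : ContDiff ℝ 1 φ)
    (hc : HasCompactSupport φ) (v : ℝ × ℝ) :
    ∫ p, u p * fderiv ℝ φ p v = -∫ p, fderiv ℝ u p v * φ p := by
  have hu' : Continuous fun p => fderiv ℝ u p v :=
    (hu.continuous_fderiv one_ne_zero).clm_apply continuous_const
  have hφ' : Continuous fun p => fderiv ℝ φ p v :=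
    (hφ.continuous_fderiv one_ne_zero).clm_apply continuous_const
  exact integral_mul_fderiv_eq_neg_fderiv_mul_of_integrable
    ((hu'.mul hφ.continuous).integrable_of_hasCompactSupport hc.mul_left)
    ((hu.continuous.mul hφ').integrable_of_hasCompactSupport (hc.fderiv_apply (𝕜 := ℝ) v).mul_left)
    ((hu.continuous.mul hφ.continuous).integrable_of_hasCompactSupport hc.mul_left)
    (fun p _ => hu.differentiable one_ne_zero p) (fun p _ => hφ.differentiable one_ne_zero p)

theorem fderiv_inv_mul_zero_one {f : ℝ × ℝ → ℂ} (hf : IsLogTest f) (p : ℝ × ℝ) :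
    pdθ (fun q => (1 / (q.1 : ℂ)) * f q) p = (1 / (p.1 : ℂ)) * pdθ f p := by
  have h1 : HasLineDerivAt ℝ (fun q : ℝ × ℝ => (1 / (q.1 : ℂ)) * f q)
      ((1 / (p.1 : ℂ)) * pdθ f p) p (0, 1) := by
    have h := (hf.1.differentiable (by simp) p).hasFDerivAt.hasLineDerivAt (0, 1)
    unfold HasLineDerivAt at h ⊢
    simpa [pdθ] using h.const_mul (1 / (p.1 : ℂ))
  have h2 := (hf.inv_mul.1.differentiable (by simp) p).hasFDerivAt.hasLineDerivAt (0, 1)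
  exact h2.unique h1

theorem integral_mul_polarLap {u φ : ℝ × ℝ → ℂ} (hu : ContDiff ℝ 2 u) (hφ : IsLogTest φ) :
    ∫ p, u p * polarLap φ p ∂polarMeasure = ∫ p, polarLap u p * φ p ∂polarMeasure := by
  have hfst : ContDiff ℝ (⊤ : ℕ∞) (fun p : ℝ × ℝ => (p.1 : ℂ)) :=
    Complex.ofRealCLM.contDiff.comp contDiff_fst
  have hfst' (p : ℝ × ℝ) : fderiv ℝ (fun p : ℝ × ℝ => (p.1 : ℂ)) p (1, 0) = 1 := by
    have := (Complex.ofRealCLM.hasFDerivAt.comp p (hasFDerivAt_fst (𝕜 := ℝ) (p := p))).fderiv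
    exact (congrArg (fun L : ℝ × ℝ →L[ℝ] ℂ => L (1, 0)) this).trans (by simp)
  have hu1 : ContDiff ℝ 1 u := hu.of_le (by norm_num)
  have hdu (v : ℝ × ℝ) : ContDiff ℝ 1 (fun p => fderiv ℝ u p v) :=
    (hu.fderiv_right (m := 1) (by norm_num)).clm_apply contDiff_const
  have h1 {f : ℝ × ℝ → ℂ} (hf : IsLogTest f) : ContDiff ℝ 1 f := hf.1.of_le (by simp)
  have hrp : IsLogTest (fun p => (p.1 : ℂ) * pdr φ p) := hφ.pdr.mul_of_contDiffOn hfst.contDiffOn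
  have hinv := hφ.inv_mul
  have hi {f g : ℝ × ℝ → ℂ} (hf : Continuous f) (hg : IsLogTest g) :
      Integrable (fun p => f p * g p) :=
    (hf.mul hg.1.continuous).integrable_of_hasCompactSupport hg.2.1.mul_left
  have hru : ContDiff ℝ 1 (fun p => (p.1 : ℂ) * pdr u p) := (hfst.of_le (by simp)).mul (hdu _)
  have key : ∀ (f : ℝ × ℝ → ℂ), ContDiff ℝ 1 (pdr f) → ∀ p,
      pdr (fun q => (q.1 : ℂ) * pdr f q) p = (p.1 : ℂ) * pdr (pdr f) p + pdr f p := by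
    intro f hf p
    rw [pdr, fderiv_fun_mul (hfst.differentiable (by simp) p) (hf.differentiable one_ne_zero p)]
    simp [hfst', pdr]
  have hr : ∫ p, u p * pdr (fun q => (q.1 : ℂ) * pdr φ q) p =
      ∫ p, pdr (fun q => (q.1 : ℂ) * pdr u q) p * φ p := by
    have e1 := integral_mul_fderiv_eq_neg hu1 (h1 hrp) hrp.2.1 (1, 0)
    have e2 := integral_mul_fderiv_eq_neg hru (h1 hφ) hφ.2.1 (1, 0)
    have e3 : ∫ p, fderiv ℝ u p (1, 0) * ((p.1 : ℂ) * pdr φ p) =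
        ∫ p, ((p.1 : ℂ) * pdr u p) * fderiv ℝ φ p (1, 0) :=
      integral_congr_ae (.of_forall fun p => by simp only [pdr]; ring)
    rw [e3, e2, neg_neg] at e1
    exact e1
  have hθ : ∫ p, u p * pdθ (pdθ (fun q => (1 / (q.1 : ℂ)) * φ q)) p =
      ∫ p, pdθ (pdθ u) p * ((1 / (p.1 : ℂ)) * φ p) := by
    have e1 := integral_mul_fderiv_eq_neg hu1 (h1 hinv.pdθ) hinv.pdθ.2.1 (0, 1)
    have e2 := integral_mul_fderiv_eq_neg (hdu (0, 1)) (h1 hinv) hinv.2.1 (0, 1)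
    exact e1.trans ((congrArg Neg.neg e2).trans (neg_neg _))
  have hθ' (p : ℝ × ℝ) : pdθ (pdθ (fun q => (1 / (q.1 : ℂ)) * φ q)) p =
      (1 / (p.1 : ℂ)) * pdθ (pdθ φ) p := by
    rw [funext (fderiv_inv_mul_zero_one hφ), fderiv_inv_mul_zero_one hφ.pdθ]
  rw [integral_polarMeasure fun p hp => by rw [hφ.polarLap.eq_zero hp, mul_zero],
    integral_polarMeasure fun p hp => by rw [hφ.eq_zero hp, mul_zero]]
  have hcθ : Continuous (pdθ (pdθ u)) :=
    ((hdu (0, 1)).continuous_fderiv one_ne_zero).clm_apply continuous_const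
  have hcr : Continuous fun p => pdr (fun q => (q.1 : ℂ) * pdr u q) p :=
    (hru.continuous_fderiv one_ne_zero).clm_apply continuous_const
  calc ∫ p : ℝ × ℝ, (p.1 : ℂ) * (u p * polarLap φ p)
      = ∫ p : ℝ × ℝ, (u p * pdr (fun q => (q.1 : ℂ) * pdr φ q) p +
          u p * pdθ (pdθ (fun q => (1 / (q.1 : ℂ)) * φ q)) p) := by
        refine integral_congr_ae (.of_forall fun p => ?_)
        simp only [hθ', key φ (h1 hφ.pdr), polarLap]
        rcases eq_or_ne p.1 0 with h | h
        · simp [hφ.pdr.eq_zero h.le, h]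
        · have : (p.1 : ℂ) ≠ 0 := by exact_mod_cast h
          field_simp
    _ = ∫ p : ℝ × ℝ, (pdr (fun q => (q.1 : ℂ) * pdr u q) p * φ p +
          pdθ (pdθ u) p * ((1 / (p.1 : ℂ)) * φ p)) := by
        rw [integral_add (hi hu.continuous hrp.pdr) (hi hu.continuous hinv.pdθ.pdθ),
          integral_add (hi hcr hφ) (hi hcθ hinv), hr, hθ]
    _ = ∫ p : ℝ × ℝ, (p.1 : ℂ) * (polarLap u p * φ p) := by
        refine integral_congr_ae (.of_forall fun p => ?_)
        simp only [key u (hdu _), polarLap]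
        rcases eq_or_ne p.1 0 with h | h
        · simp [hφ.eq_zero h.le]
        · have : (p.1 : ℂ) ≠ 0 := by exact_mod_cast h
          field_simp

/-! ### The kernel `exp (-w cosh t) cosh (t / 2)` -/

theorem integral_comp_sinh_half {E : Type*} [NormedAddCommGroup E] [NormedSpace ℝ E] (g : ℝ → E) :
    ∫ t : ℝ, (Real.cosh (t / 2) / 2) • g (Real.sinh (t / 2)) = ∫ u, g u ∧
    (Integrable g → Integrable fun t : ℝ => (Real.cosh (t / 2) / 2) • g (Real.sinh (t / 2))) := by
  have hd (x : ℝ) (_ : x ∈ univ) : HasDerivWithinAt (fun t : ℝ => Real.sinh (t / 2))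
      (Real.cosh (x / 2) / 2) univ x := by
    have := ((Real.hasDerivAt_sinh (x / 2)).comp x ((hasDerivAt_id x).div_const 2))
    exact (this.congr_deriv (by ring)).hasDerivWithinAt
  have hinj : InjOn (fun t : ℝ => Real.sinh (t / 2)) univ := fun x _ y _ h => by
    have := Real.sinh_injective h
    linarith
  have himg : (fun t : ℝ => Real.sinh (t / 2)) '' univ = univ := by
    rw [image_univ]
    refine Function.Surjective.range_eq fun y => ?_
    obtain ⟨x, hx⟩ := Real.sinh_surjective y
    exact ⟨2 * x, by simpa using hx⟩
  have habs (x : ℝ) : |Real.cosh (x / 2) / 2| = Real.cosh (x / 2) / 2 :=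
    abs_of_pos (by have := Real.cosh_pos (x / 2); positivity)
  have h1 := integral_image_eq_integral_abs_deriv_smul MeasurableSet.univ hd hinj g
  have h2 := integrableOn_image_iff_integrableOn_abs_deriv_smul MeasurableSet.univ hd hinj g
  simp only [himg, habs, setIntegral_univ, integrableOn_univ] at h1 h2
  exact ⟨h1.symm, h2.1⟩

theorem cosh_eq_one_add_two_mul_sinh_half_sq (t : ℝ) :
    Real.cosh t = 1 + 2 * Real.sinh (t / 2) ^ 2 := by
  have h := Real.cosh_two_mul (t / 2)
  have h' := Real.cosh_sq (t / 2)
  rw [show 2 * (t / 2) = t by ring] at h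
  linarith

theorem kernel_integral {w : ℂ} (hw : 0 < w.re) :
    Integrable (fun t : ℝ => Complex.exp (-(w * (Real.cosh t : ℝ))) * (Real.cosh (t / 2) : ℝ)) ∧
    ∫ t : ℝ, Complex.exp (-(w * (Real.cosh t : ℝ))) * (Real.cosh (t / 2) : ℝ) =
      2 * Complex.exp (-w) * ((Real.pi : ℂ) / (2 * w)) ^ (1 / 2 : ℂ) := by
  have hw2 : 0 < (2 * w).re := by simpa using hw
  have hg : Integrable fun u : ℝ => 2 * Complex.exp (-w) * Complex.exp (-(2 * w) * u ^ 2) :=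
    (integrable_cexp_neg_mul_sq hw2).const_mul _
  have he (t : ℝ) : Complex.exp (-(w * (Real.cosh t : ℝ))) * (Real.cosh (t / 2) : ℝ) =
      (Real.cosh (t / 2) / 2) • (fun u : ℝ => 2 * Complex.exp (-w) *
        Complex.exp (-(2 * w) * u ^ 2)) (Real.sinh (t / 2)) := by
    rw [cosh_eq_one_add_two_mul_sinh_half_sq t, Complex.real_smul]
    beta_reduce
    rw [mul_assoc 2, ← Complex.exp_add]
    push_cast
    ring_nf
  obtain ⟨h1, h2⟩ := integral_comp_sinh_half
    fun u : ℝ => 2 * Complex.exp (-w) * Complex.exp (-(2 * w) * u ^ 2)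
  simp only [he]
  refine ⟨h2 hg, h1.trans ?_⟩
  rw [integral_const_mul, integral_gaussian_complex hw2]

/-- The positive majorant used in all the estimates below. -/
noncomputable def majorant (b t : ℝ) : ℝ := Real.exp (-(b * Real.cosh t)) * Real.cosh (t / 2)

theorem majorant_nonneg (b t : ℝ) : 0 ≤ majorant b t :=
  mul_nonneg (Real.exp_pos _).le (Real.cosh_pos _).le

theorem majorant_anti {b c : ℝ} (h : b ≤ c) (t : ℝ) : majorant c t ≤ majorant b t := by
  have h1 := Real.cosh_pos t
  have h2 := Real.cosh_pos (t / 2)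
  unfold majorant
  gcongr

theorem majorant_integral {b : ℝ} (hb : 0 < b) :
    Integrable (majorant b) ∧
      ∫ t, majorant b t = 2 * Real.exp (-b) * √(Real.pi / (2 * b)) := by
  have hg : Integrable fun u : ℝ => 2 * Real.exp (-b) * Real.exp (-(2 * b) * u ^ 2) :=
    (integrable_exp_neg_mul_sq (by positivity)).const_mul _
  have he : majorant b = fun t => (Real.cosh (t / 2) / 2) • (fun u : ℝ => 2 * Real.exp (-b) *
        Real.exp (-(2 * b) * u ^ 2)) (Real.sinh (t / 2)) := by
    ext t
    rw [majorant, cosh_eq_one_add_two_mul_sinh_half_sq t, smul_eq_mul]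
    beta_reduce
    rw [mul_assoc 2, ← Real.exp_add]
    ring_nf
  obtain ⟨h1, h2⟩ := integral_comp_sinh_half
    fun u : ℝ => 2 * Real.exp (-b) * Real.exp (-(2 * b) * u ^ 2)
  rw [he]
  refine ⟨h2 hg, h1.trans ?_⟩
  rw [integral_const_mul, integral_gaussian]

theorem exists_quadratic_le_mul_exp {a A B C : ℝ} (ha : 0 < a) (hA : 0 ≤ A) (hB : 0 ≤ B)
    (hC : 0 ≤ C) :
    ∃ K, 0 ≤ K ∧ ∀ x, 0 ≤ x → A * x ^ 2 + B * x + C ≤ K * Real.exp (a * x) := by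
  refine ⟨A * (2 / a ^ 2) + B / a + C, by positivity, fun x hx => ?_⟩
  have h := Real.quadratic_le_exp_of_nonneg (mul_nonneg ha.le hx)
  have hax := mul_nonneg ha.le hx
  have h1 : A * x ^ 2 ≤ A * (2 / a ^ 2) * Real.exp (a * x) := by
    rw [show A * x ^ 2 = A * (2 / a ^ 2) * ((a * x) ^ 2 / 2) by field_simp]
    gcongr
    nlinarith
  have h2 : B * x ≤ B / a * Real.exp (a * x) := by
    rw [show B * x = B / a * (a * x) by field_simp]
    gcongr
    nlinarith
  have h3 : C ≤ C * Real.exp (a * x) := le_mul_of_one_le_right hC (Real.one_le_exp hax)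
  linarith

/-! ### Entire functions of exponential growth `1 / 2` along the real axis -/

/-- Entire functions bounded by a multiple of `cosh (Re z / 2)`. -/
def HalfGrowth (F : ℂ → ℂ) : Prop :=
  Differentiable ℂ F ∧ ∃ C, 0 ≤ C ∧ ∀ z : ℂ, ‖F z‖ ≤ C * Real.cosh (z.re / 2)

theorem cosh_half_le {x y : ℝ} (h : |y - x| ≤ 1) :
    Real.cosh (y / 2) ≤ 2 * Real.cosh (1 / 2) * Real.cosh (x / 2) := by
  have h1 : Real.cosh ((y - x) / 2) ≤ Real.cosh (1 / 2) := by
    rw [Real.cosh_le_cosh, abs_div, abs_of_pos (by norm_num : (0 : ℝ) < 2),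
      abs_of_pos (by norm_num : (0 : ℝ) < 1 / 2)]
    linarith
  have h2 (u v : ℝ) : Real.cosh (u + v) ≤ 2 * (Real.cosh u * Real.cosh v) := by
    have := Real.cosh_pos (u - v)
    rw [Real.cosh_sub] at this
    rw [Real.cosh_add]
    linarith
  calc Real.cosh (y / 2) = Real.cosh ((y - x) / 2 + x / 2) := by ring_nf
    _ ≤ 2 * (Real.cosh ((y - x) / 2) * Real.cosh (x / 2)) := h2 _ _
    _ ≤ 2 * (Real.cosh (1 / 2) * Real.cosh (x / 2)) := by
      have := Real.cosh_pos (x / 2)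
      gcongr
    _ = _ := by ring

theorem HalfGrowth.deriv {F : ℂ → ℂ} (hF : HalfGrowth F) : HalfGrowth (deriv F) := by
  obtain ⟨hd, C, hC, h⟩ := hF
  refine ⟨fun z => (hd.analyticAt z).deriv.differentiableAt, C * (2 * Real.cosh (1 / 2)),
    by have := Real.cosh_pos (1 / 2); positivity, fun z => ?_⟩
  have := Complex.norm_deriv_le_of_forall_mem_sphere_norm_le (c := z) one_pos hd.diffContOnCl
    (C := C * (2 * Real.cosh (1 / 2) * Real.cosh (z.re / 2))) fun y hy => (h y).trans <|
      mul_le_mul_of_nonneg_left (cosh_half_le ?_) hC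
  · simpa [mul_assoc] using this
  · have h1 := Complex.abs_re_le_norm (y - z)
    rw [mem_sphere_iff_norm.1 hy] at h1
    simpa using h1

/-! ### Superpositions of exponential waves -/

/-- The elementary wave `exp (-ω r cosh t) F (t + i θ)`. -/
noncomputable def wave (ω : ℂ) (F : ℂ → ℂ) (t : ℝ) (p : ℝ × ℝ) : ℂ :=
  Complex.exp (-(ω * p.1 * (Real.cosh t : ℝ))) * F (t + p.2 * Complex.I)

/-- The superposition `∫ exp (-ω r cosh t) F (t + i θ) dt` of elementary waves. -/
noncomputable def superposition (ω : ℂ) (F : ℂ → ℂ) (p : ℝ × ℝ) : ℂ := ∫ t : ℝ, wave ω F t p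

theorem continuous_wave (ω : ℂ) {F : ℂ → ℂ} (hF : Continuous F) :
    Continuous (Function.uncurry (wave ω F)) := by
  unfold wave Function.uncurry
  fun_prop

theorem contDiff_wave (ω : ℂ) {F : ℂ → ℂ} (hF : Differentiable ℂ F) (t : ℝ) :
    ContDiff ℝ 2 (wave ω F t) := by
  have hr : ContDiff ℝ 2 (fun p : ℝ × ℝ => (p.1 : ℂ)) :=
    Complex.ofRealCLM.contDiff.comp contDiff_fst
  have hθ : ContDiff ℝ 2 (fun p : ℝ × ℝ => (p.2 : ℂ)) :=
    Complex.ofRealCLM.contDiff.comp contDiff_snd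
  have hF' : ContDiff ℝ 2 F := (hF.contDiff (n := 2)).restrict_scalars ℝ
  exact ((contDiff_const.mul hr).mul contDiff_const).neg.cexp.mul
    (hF'.comp (contDiff_const.add (hθ.mul contDiff_const)))

theorem pdr_eq_of_hasDerivAt {f : ℝ × ℝ → ℂ} {p : ℝ × ℝ} {v : ℂ} (hf : DifferentiableAt ℝ f p)
    (h : HasDerivAt (fun r => f (r, p.2)) v p.1) : pdr f p = v :=
  (HasFDerivAt.comp_hasDerivAt (f := fun r => (r, p.2)) p.1 hf.hasFDerivAt
    ((hasDerivAt_id p.1).prodMk (hasDerivAt_const p.1 p.2))).unique h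

theorem pdθ_eq_of_hasDerivAt {f : ℝ × ℝ → ℂ} {p : ℝ × ℝ} {v : ℂ} (hf : DifferentiableAt ℝ f p)
    (h : HasDerivAt (fun θ => f (p.1, θ)) v p.2) : pdθ f p = v :=
  (HasFDerivAt.comp_hasDerivAt (f := fun θ => (p.1, θ)) p.2 hf.hasFDerivAt
    ((hasDerivAt_const p.2 p.1).prodMk (hasDerivAt_id p.2))).unique h

theorem pdr_wave (ω : ℂ) {F : ℂ → ℂ} (hF : Differentiable ℂ F) (t : ℝ) :
    pdr (wave ω F t) = fun p => -(ω * (Real.cosh t : ℝ)) * wave ω F t p := by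
  ext p
  refine pdr_eq_of_hasDerivAt ((contDiff_wave ω hF t).differentiable two_ne_zero p) ?_
  have h := ((((hasDerivAt_id p.1).ofReal_comp.const_mul ω).mul_const
    ((Real.cosh t : ℝ) : ℂ)).neg.cexp).mul_const (F (t + p.2 * Complex.I))
  refine h.congr_deriv ?_
  simp [wave]
  ring

theorem pdθ_wave (ω : ℂ) {F : ℂ → ℂ} (hF : Differentiable ℂ F) (t : ℝ) :
    pdθ (wave ω F t) = fun p => Complex.I * wave ω (deriv F) t p := by
  ext p
  refine pdθ_eq_of_hasDerivAt ((contDiff_wave ω hF t).differentiable two_ne_zero p) ?_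
  have h1 : HasDerivAt (fun θ : ℝ => (t : ℂ) + θ * Complex.I) Complex.I p.2 := by
    simpa using ((hasDerivAt_id p.2).ofReal_comp.mul_const Complex.I).const_add (t : ℂ)
  have h := ((hF _).hasDerivAt.comp p.2 h1).const_mul
    (Complex.exp (-(ω * p.1 * (Real.cosh t : ℝ))))
  refine h.congr_deriv ?_
  simp only [wave]
  ring

theorem pdr_const_mul (c : ℂ) (f : ℝ × ℝ → ℂ) : pdr (fun p => c * f p) = fun p => c * pdr f p := by
  ext p
  exact congrArg (fun L : ℝ × ℝ → ℝ × ℝ →L[ℝ] ℂ => L p (1, 0))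
    (fderiv_const_smul_field (𝕜 := ℝ) (f := f) c)

theorem pdθ_const_mul (c : ℂ) (f : ℝ × ℝ → ℂ) : pdθ (fun p => c * f p) = fun p => c * pdθ f p := by
  ext p
  exact congrArg (fun L : ℝ × ℝ → ℝ × ℝ →L[ℝ] ℂ => L p (0, 1))
    (fderiv_const_smul_field (𝕜 := ℝ) (f := f) c)

/-- `r ^ 2 (Δ - ω ^ 2)` applied to an elementary wave; see `hasDerivAt_waveFlux` for its
expression as a derivative in `t`. -/
noncomputable def waveDefect (ω : ℂ) (F : ℂ → ℂ) (t : ℝ) (p : ℝ × ℝ) : ℂ :=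
  (ω ^ 2 * p.1 ^ 2 * (Real.sinh t : ℝ) ^ 2 - ω * p.1 * (Real.cosh t : ℝ)) * wave ω F t p -
    wave ω (deriv (deriv F)) t p

/-- The primitive in `t` of `waveDefect`. -/
noncomputable def waveFlux (ω : ℂ) (F : ℂ → ℂ) (t : ℝ) (p : ℝ × ℝ) : ℂ :=
  -(ω * p.1 * (Real.sinh t : ℝ)) * wave ω F t p - wave ω (deriv F) t p

theorem differentiable_deriv {F : ℂ → ℂ} (hF : Differentiable ℂ F) : Differentiable ℂ (deriv F) :=
  fun z => (hF.analyticAt z).deriv.differentiableAt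

theorem polarLap_wave (ω : ℂ) {F : ℂ → ℂ} (hF : Differentiable ℂ F) (t : ℝ) {p : ℝ × ℝ}
    (hp : p.1 ≠ 0) :
    polarLap (wave ω F t) p - ω ^ 2 * wave ω F t p =
      waveDefect ω F t p * ((1 / (p.1 : ℂ)) * (1 / (p.1 : ℂ))) := by
  have hp' : (p.1 : ℂ) ≠ 0 := by exact_mod_cast hp
  have hsq : ((Real.cosh t : ℝ) : ℂ) ^ 2 = ((Real.sinh t : ℝ) : ℂ) ^ 2 + 1 := by
    exact_mod_cast Real.cosh_sq t
  rw [polarLap, pdr_wave ω hF, pdr_const_mul, pdr_wave ω hF, pdθ_wave ω hF, pdθ_const_mul,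
    pdθ_wave ω (differentiable_deriv hF), waveDefect]
  field_simp
  linear_combination (ω ^ 2 * p.1 ^ 2 * wave ω F t p) * hsq +
    wave ω (deriv (deriv F)) t p * Complex.I_sq

theorem hasDerivAt_wave (ω : ℂ) {F : ℂ → ℂ} (hF : Differentiable ℂ F) (t : ℝ) (p : ℝ × ℝ) :
    HasDerivAt (fun t => wave ω F t p)
      (-(ω * p.1 * (Real.sinh t : ℝ)) * wave ω F t p + wave ω (deriv F) t p) t := by
  have h1 := ((Real.hasDerivAt_cosh t).ofReal_comp.const_mul (ω * p.1)).neg.cexp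
  have h2 : HasDerivAt (fun t : ℝ => (t : ℂ) + p.2 * Complex.I) 1 t := by
    simpa using (hasDerivAt_id t).ofReal_comp.add_const (p.2 * Complex.I)
  refine (h1.mul ((hF _).hasDerivAt.comp t h2)).congr_deriv ?_
  simp only [wave, Function.comp, Pi.neg_apply]
  ring

theorem hasDerivAt_waveFlux (ω : ℂ) {F : ℂ → ℂ} (hF : Differentiable ℂ F) (t : ℝ) (p : ℝ × ℝ) :
    HasDerivAt (fun t => waveFlux ω F t p) (waveDefect ω F t p) t := by
  have h1 := ((Real.hasDerivAt_sinh t).ofReal_comp.const_mul (ω * p.1)).neg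
  refine ((h1.mul (hasDerivAt_wave ω hF t p)).sub
    (hasDerivAt_wave ω (differentiable_deriv hF) t p)).congr_deriv ?_
  simp only [waveDefect, Pi.neg_apply]
  ring

theorem norm_wave (ω : ℂ) (F : ℂ → ℂ) (t : ℝ) (p : ℝ × ℝ) :
    ‖wave ω F t p‖ =
      Real.exp (-(ω.re * p.1 * Real.cosh t)) * ‖F (t + p.2 * Complex.I)‖ := by
  have : (-(ω * p.1 * (Real.cosh t : ℝ))).re = -(ω.re * p.1 * Real.cosh t) := by
    rw [Complex.neg_re, Complex.re_mul_ofReal, Complex.re_mul_ofReal]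
  rw [wave, norm_mul, Complex.norm_exp, this]

theorem exists_norm_wave_le (ω : ℂ) {F : ℂ → ℂ} (hF : HalfGrowth F) :
    ∃ C, 0 ≤ C ∧ ∀ t p, ‖wave ω F t p‖ ≤ C * majorant (ω.re * p.1) t := by
  obtain ⟨-, C, hC, h⟩ := hF
  refine ⟨C, hC, fun t p => ?_⟩
  have := h (t + p.2 * Complex.I)
  simp only [Complex.add_re, Complex.ofReal_re, Complex.re_ofReal_mul, Complex.I_re, mul_zero,
    add_zero] at this
  rw [norm_wave, majorant]
  calc _ ≤ Real.exp (-(ω.re * p.1 * Real.cosh t)) * (C * Real.cosh (t / 2)) := by gcongr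
    _ = _ := by ring

theorem exists_norm_wave_poly_le {ω : ℂ} (hω : 0 < ω.re) {F F₁ F₂ : ℂ → ℂ} (hF : HalfGrowth F)
    (hF₁ : HalfGrowth F₁) (hF₂ : HalfGrowth F₂) :
    ∃ K, 0 ≤ K ∧ ∀ t (p : ℝ × ℝ), 0 < p.1 →
      (‖ω‖ ^ 2 * (p.1 * Real.cosh t) ^ 2 + ‖ω‖ * (p.1 * Real.cosh t)) * ‖wave ω F t p‖ +
        (‖wave ω F₁ t p‖ + ‖wave ω F₂ t p‖) ≤ K * majorant (ω.re / 2 * p.1) t := by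
  obtain ⟨C, hC, h⟩ := exists_norm_wave_le ω hF
  obtain ⟨C₁, hC₁, h₁⟩ := exists_norm_wave_le ω hF₁
  obtain ⟨C₂, hC₂, h₂⟩ := exists_norm_wave_le ω hF₂
  obtain ⟨K, hK, hpoly⟩ := exists_quadratic_le_mul_exp (half_pos hω)
    (A := ‖ω‖ ^ 2 * C) (B := ‖ω‖ * C) (C := C₁ + C₂) (by positivity) (by positivity)
    (by positivity)
  refine ⟨K, hK, fun t p hp => ?_⟩
  set x := p.1 * Real.cosh t with hx
  have hx0 : 0 ≤ x := mul_nonneg hp.le (Real.cosh_pos t).le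
  have hm : Real.exp (ω.re / 2 * x) * majorant (ω.re * p.1) t = majorant (ω.re / 2 * p.1) t := by
    rw [majorant, majorant, ← mul_assoc, ← Real.exp_add]
    congr 2
    rw [hx]
    ring
  have hM := majorant_nonneg (ω.re * p.1) t
  calc _ ≤ (‖ω‖ ^ 2 * x ^ 2 + ‖ω‖ * x) * (C * majorant (ω.re * p.1) t) +
        (C₁ * majorant (ω.re * p.1) t + C₂ * majorant (ω.re * p.1) t) := by
        gcongr
        · exact h t p
        · exact h₁ t p
        · exact h₂ t p
    _ = (‖ω‖ ^ 2 * C * x ^ 2 + ‖ω‖ * C * x + (C₁ + C₂)) * majorant (ω.re * p.1) t := by ring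
    _ ≤ K * Real.exp (ω.re / 2 * x) * majorant (ω.re * p.1) t := by
        gcongr
        exact hpoly x hx0
    _ = _ := by rw [mul_assoc, hm]

theorem abs_sinh_le_cosh (t : ℝ) : |Real.sinh t| ≤ Real.cosh t :=
  abs_le_of_sq_le_sq (by rw [Real.cosh_sq]; linarith) (Real.cosh_pos t).le

theorem exists_norm_waveDefect_le {ω : ℂ} (hω : 0 < ω.re) {F : ℂ → ℂ} (hF : HalfGrowth F) :
    ∃ K, 0 ≤ K ∧ ∀ t (p : ℝ × ℝ), 0 < p.1 →
      ‖waveDefect ω F t p‖ ≤ K * majorant (ω.re / 2 * p.1) t ∧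
      ‖waveFlux ω F t p‖ ≤ K * majorant (ω.re / 2 * p.1) t := by
  obtain ⟨K, hK, h⟩ := exists_norm_wave_poly_le hω hF hF.deriv hF.deriv.deriv
  refine ⟨K, hK, fun t p hp => ?_⟩
  have hc := Real.cosh_pos t
  have hx : 0 ≤ p.1 * Real.cosh t := mul_nonneg hp.le hc.le
  have hs : ‖ω * p.1 * (Real.sinh t : ℝ)‖ ≤ ‖ω‖ * (p.1 * Real.cosh t) := by
    rw [norm_mul, norm_mul, Complex.norm_real, Complex.norm_real, Real.norm_of_nonneg hp.le,
      mul_assoc]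
    exact mul_le_mul_of_nonneg_left (mul_le_mul_of_nonneg_left (abs_sinh_le_cosh t) hp.le)
      (norm_nonneg ω)
  have hs2 : ‖ω ^ 2 * p.1 ^ 2 * (Real.sinh t : ℝ) ^ 2‖ ≤ ‖ω‖ ^ 2 * (p.1 * Real.cosh t) ^ 2 := by
    rw [← mul_pow, ← mul_pow, norm_pow, ← mul_pow]
    exact pow_le_pow_left₀ (norm_nonneg _) hs 2
  have hc1 : ‖ω * p.1 * (Real.cosh t : ℝ)‖ = ‖ω‖ * (p.1 * Real.cosh t) := by
    rw [norm_mul, norm_mul, Complex.norm_real, Complex.norm_real, Real.norm_of_nonneg hp.le,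
      Real.norm_of_nonneg hc.le, mul_assoc]
  have hW := norm_nonneg (wave ω F t p)
  have h0 := h t p hp
  rw [waveDefect, waveFlux]
  constructor
  · refine ((norm_sub_le _ _).trans ?_).trans h0
    rw [norm_mul]
    exact add_le_add (mul_le_mul_of_nonneg_right ((norm_sub_le _ _).trans (add_le_add hs2 hc1.le))
      hW) (le_add_of_nonneg_left (norm_nonneg _))
  · refine ((norm_sub_le _ _).trans ?_).trans h0
    rw [norm_mul, norm_neg]
    exact add_le_add (mul_le_mul_of_nonneg_right (le_add_of_nonneg_of_le (by positivity) hs)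
      hW) (le_add_of_nonneg_right (norm_nonneg _))

theorem continuous_wave_left (ω : ℂ) {G : ℂ → ℂ} (hG : Continuous G) (p : ℝ × ℝ) :
    Continuous fun t => wave ω G t p := by
  unfold wave
  fun_prop

theorem continuous_waveDefect (ω : ℂ) {F : ℂ → ℂ} (hF : Differentiable ℂ F) (p : ℝ × ℝ) :
    Continuous fun t => waveDefect ω F t p := by
  have h₀ := continuous_wave_left ω hF.continuous p
  have h₂ := continuous_wave_left ω (differentiable_deriv (differentiable_deriv hF)).continuous p
  unfold waveDefect
  fun_prop

theorem continuous_waveFlux (ω : ℂ) {F : ℂ → ℂ} (hF : Differentiable ℂ F) (p : ℝ × ℝ) :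
    Continuous fun t => waveFlux ω F t p := by
  have h₀ := continuous_wave_left ω hF.continuous p
  have h₁ := continuous_wave_left ω (differentiable_deriv hF).continuous p
  unfold waveFlux
  fun_prop

theorem integral_waveDefect {ω : ℂ} (hω : 0 < ω.re) {F : ℂ → ℂ} (hF : HalfGrowth F)
    {p : ℝ × ℝ} (hp : 0 < p.1) : ∫ t, waveDefect ω F t p = 0 := by
  obtain ⟨K, hK, h⟩ := exists_norm_waveDefect_le hω hF
  have hm : Integrable (fun t => K * majorant (ω.re / 2 * p.1) t) volume :=
    (majorant_integral (mul_pos (half_pos hω) hp)).1.const_mul K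
  have hD : Integrable (fun t => waveDefect ω F t p) :=
    hm.mono' (continuous_waveDefect ω hF.1 p).aestronglyMeasurable
      (.of_forall fun t => (h t p hp).1)
  have hV : Integrable (fun t => waveFlux ω F t p) :=
    hm.mono' (continuous_waveFlux ω hF.1 p).aestronglyMeasurable
      (.of_forall fun t => (h t p hp).2)
  exact integral_eq_zero_of_hasDerivAt_of_integrable
    (fun t => hasDerivAt_waveFlux ω hF.1 t p) hD hV

theorem integral_integral_mul_isLogTest {H : ℝ → ℝ × ℝ → ℂ} {φ : ℝ × ℝ → ℂ} {h : ℝ → ℝ}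
    (hH : Continuous (Function.uncurry H)) (hφ : IsLogTest φ) (hh : Integrable h)
    (hle : ∀ t p, φ p ≠ 0 → ‖H t p‖ ≤ h t) :
    ∫ p, (∫ t, H t p) * φ p ∂polarMeasure = ∫ t, ∫ p, H t p * φ p ∂polarMeasure := by
  have hint : Integrable (Function.uncurry fun t p => H t p * φ p) (volume.prod polarMeasure) := by
    refine (hh.mul_prod hφ.integrable.norm).mono'
      (hH.mul (hφ.1.continuous.comp continuous_snd)).aestronglyMeasurable (.of_forall fun z => ?_)
    rw [Function.uncurry, norm_mul]
    by_cases hz : φ z.2 = 0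
    · simp [hz]
    · exact mul_le_mul_of_nonneg_right (hle _ _ hz) (norm_nonneg _)
  rw [integral_integral_swap hint]
  exact integral_congr_ae (.of_forall fun p => (integral_mul_const _ _).symm)

theorem continuous_uncurry_waveDefect (ω : ℂ) {F : ℂ → ℂ} (hF : Differentiable ℂ F) :
    Continuous (Function.uncurry (waveDefect ω F)) := by
  have h₀ : Continuous fun q : ℝ × ℝ × ℝ => wave ω F q.1 q.2 := continuous_wave ω hF.continuous
  have h₂ : Continuous fun q : ℝ × ℝ × ℝ => wave ω (deriv (deriv F)) q.1 q.2 :=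
    continuous_wave ω (differentiable_deriv (differentiable_deriv hF)).continuous
  unfold waveDefect Function.uncurry
  fun_prop

/-- The superposition solves `Δ u = ω ^ 2 u` weakly. -/
theorem integral_superposition_mul_polarLap_sub {ω : ℂ} (hω : 0 < ω.re) {F : ℂ → ℂ}
    (hF : HalfGrowth F) {φ : ℝ × ℝ → ℂ} (hφ : IsLogTest φ) :
    ∫ p, superposition ω F p * (polarLap φ p - ω ^ 2 * φ p) ∂polarMeasure = 0 := by
  have hχ := hφ.polarLap.sub (hφ.const_mul (ω ^ 2))
  obtain ⟨ε, hε, hle⟩ := hχ.exists_pos_forall_le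
  obtain ⟨δ, hδ, hle'⟩ := hφ.inv_mul.inv_mul.exists_pos_forall_le
  obtain ⟨C, hC, hw⟩ := exists_norm_wave_le ω hF
  obtain ⟨K, hK, hd⟩ := exists_norm_waveDefect_le hω hF
  have h₁ := integral_integral_mul_isLogTest (continuous_wave ω hF.1.continuous) hχ
    ((majorant_integral (mul_pos hω hε)).1.const_mul C) fun t p hp => by
      refine (hw t p).trans (mul_le_mul_of_nonneg_left (majorant_anti ?_ t) hC)
      exact mul_le_mul_of_nonneg_left (not_lt.1 fun h => hp (hle p h)) hω.le
  have h₂ := integral_integral_mul_isLogTest (continuous_uncurry_waveDefect ω hF.1)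
    hφ.inv_mul.inv_mul ((majorant_integral (mul_pos (half_pos hω) hδ)).1.const_mul K)
    fun t p hp => by
      have hδp : δ ≤ p.1 := not_lt.1 fun h => hp (hle' p h)
      refine (hd t p (hδ.trans_le hδp)).1.trans
        (mul_le_mul_of_nonneg_left (majorant_anti ?_ t) hK)
      exact mul_le_mul_of_nonneg_left hδp (half_pos hω).le
  have h₃ (t : ℝ) : ∫ p, wave ω F t p * (polarLap φ p - ω ^ 2 * φ p) ∂polarMeasure =
      ∫ p, waveDefect ω F t p * ((1 / (p.1 : ℂ)) * ((1 / (p.1 : ℂ)) * φ p)) ∂polarMeasure := by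
    have hu := contDiff_wave ω hF.1 t
    have hi {g : ℝ × ℝ → ℂ} (hg : IsLogTest g) :
        Integrable (fun p => wave ω F t p * g p) polarMeasure :=
      (hu.continuous.mul hg.1.continuous).integrable_of_hasCompactSupport hg.2.1.mul_left
    have hj : Integrable (fun p => waveDefect ω F t p *
        ((1 / (p.1 : ℂ)) * ((1 / (p.1 : ℂ)) * φ p))) polarMeasure :=
      (((continuous_uncurry_waveDefect ω hF.1).comp (.prodMk continuous_const continuous_id)).mul
        hφ.inv_mul.inv_mul.1.continuous).integrable_of_hasCompactSupport
          hφ.inv_mul.inv_mul.2.1.mul_left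
    have he : ∀ᵐ p ∂polarMeasure, polarLap (wave ω F t) p * φ p = waveDefect ω F t p *
        ((1 / (p.1 : ℂ)) * ((1 / (p.1 : ℂ)) * φ p)) + wave ω F t p * (ω ^ 2 * φ p) := by
      filter_upwards [ae_polarMeasure_pos] with p hp
      linear_combination φ p * polarLap_wave ω hF.1 t hp.ne'
    simp only [mul_sub]
    rw [integral_sub (hi hφ.polarLap) (hi (hφ.const_mul _)), integral_mul_polarLap hu hφ,
      integral_congr_ae he, integral_add hj (hi (hφ.const_mul _)), add_sub_cancel_right]
  calc _ = ∫ t, ∫ p, wave ω F t p * (polarLap φ p - ω ^ 2 * φ p) ∂polarMeasure := h₁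
    _ = ∫ t, ∫ p, waveDefect ω F t p *
        ((1 / (p.1 : ℂ)) * ((1 / (p.1 : ℂ)) * φ p)) ∂polarMeasure := by simp only [h₃]
    _ = ∫ p, (∫ t, waveDefect ω F t p) * ((1 / (p.1 : ℂ)) * ((1 / (p.1 : ℂ)) * φ p))
        ∂polarMeasure := h₂.symm
    _ = ∫ p, (0 : ℂ) ∂polarMeasure := by
      refine integral_congr_ae ?_
      filter_upwards [ae_polarMeasure_pos] with p hp
      rw [integral_waveDefect hω hF hp, zero_mul]
    _ = 0 := integral_zero _ _

theorem isDistribEigen_of_superposition {ω c : ℂ} (hω : 0 < ω.re) (hc : ω ^ 2 = starRingEnd ℂ c)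
    {F : ℂ → ℂ} (hF : HalfGrowth F) {ψ : Lp ℂ 2 polarMeasure}
    (hψ : ψ =ᵐ[polarMeasure] superposition ω F) : IsDistribEigen c ψ := by
  intro φ hφ
  rw [← integral_superposition_mul_polarLap_sub hω hF hφ.conj]
  refine integral_congr_ae ?_
  filter_upwards [hψ] with p hp
  rw [hp, polarLap_conj, map_sub, map_mul, hc]

theorem norm_superposition_le {ω : ℂ} (hω : 0 < ω.re) {F : ℂ → ℂ} {C : ℝ}
    (hF : ∀ z, ‖F z‖ * (1 + |z.im|) ≤ C * Real.cosh (z.re / 2)) {p : ℝ × ℝ} (hp : 0 < p.1) :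
    ‖superposition ω F p‖ ≤ C * (2 * Real.exp (-(ω.re * p.1)) *
      √(Real.pi / (2 * (ω.re * p.1)))) / (1 + |p.2|) := by
  have hm := majorant_integral (mul_pos hω hp)
  have hθ : 0 < 1 + |p.2| := by positivity
  rw [← hm.2, mul_div_right_comm, ← integral_const_mul]
  refine norm_integral_le_of_norm_le (hm.1.const_mul _) (.of_forall fun t => ?_)
  have h := hF (t + p.2 * Complex.I)
  simp only [Complex.add_re, Complex.ofReal_re, Complex.re_ofReal_mul, Complex.I_re, mul_zero,
    add_zero, Complex.add_im, Complex.ofReal_im, Complex.im_ofReal_mul, Complex.I_im, mul_one,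
    zero_add] at h
  rw [norm_wave, majorant, div_mul_eq_mul_div, le_div_iff₀ hθ]
  calc _ = Real.exp (-(ω.re * p.1 * Real.cosh t)) *
        (‖F (t + p.2 * Complex.I)‖ * (1 + |p.2|)) := by ring
    _ ≤ Real.exp (-(ω.re * p.1 * Real.cosh t)) * (C * Real.cosh (t / 2)) := by gcongr
    _ = _ := by ring

theorem continuousOn_superposition {ω : ℂ} (hω : 0 < ω.re) {F : ℂ → ℂ} (hF : HalfGrowth F) :
    ContinuousOn (superposition ω F) (Ioi (0 : ℝ) ×ˢ univ) := by
  obtain ⟨C, hC, hw⟩ := exists_norm_wave_le ω hF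
  intro p hp
  have hp' : 0 < p.1 := hp.1
  refine ContinuousAt.continuousWithinAt ?_
  have hmem : ∀ᶠ q : ℝ × ℝ in nhds p, p.1 / 2 < q.1 :=
    continuous_fst.continuousAt.eventually (lt_mem_nhds (half_lt_self hp'))
  refine continuousAt_of_dominated (.of_forall fun q => ?_) (hmem.mono fun q hq => .of_forall
    fun t => (hw t q).trans (mul_le_mul_of_nonneg_left (majorant_anti ?_ t) hC))
    ((majorant_integral (mul_pos hω (half_pos hp'))).1.const_mul C) (.of_forall fun t => ?_)
  · exact (continuous_wave_left ω hF.1.continuous q).aestronglyMeasurable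
  · exact mul_le_mul_of_nonneg_left hq.le hω.le
  · exact (contDiff_wave ω hF.1 t).continuous.continuousAt

theorem memLp_superposition {ω : ℂ} (hω : 0 < ω.re) {F : ℂ → ℂ} (hF : HalfGrowth F) {C : ℝ}
    (hC : ∀ z, ‖F z‖ * (1 + |z.im|) ≤ C * Real.cosh (z.re / 2)) :
    MemLp (superposition ω F) 2 polarMeasure := by
  have hcont := continuousOn_superposition hω hF
  rw [memLp_two_iff_integrable_sq_norm hcont.aestronglyMeasurable_polarMeasure,
    integrable_polarMeasure_iff]
  have hexp : IntegrableOn (fun r : ℝ => Real.exp (-(2 * ω.re) * r)) (Ioi 0) :=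
    exp_neg_integrableOn_Ioi 0 (by positivity)
  have hprod := (hexp.integrable.const_mul (C ^ 2 * (2 * Real.pi / ω.re))).mul_prod
    (integrable_inv_one_add_sq.integrableOn (s := univ)).integrable
  rw [Measure.prod_restrict, ← Measure.volume_eq_prod] at hprod
  refine hprod.mono' ?_ ?_
  · exact (continuousOn_fst.mul (hcont.norm.pow 2)).aestronglyMeasurable measurableSet_halfPlane
  · filter_upwards [ae_restrict_mem measurableSet_halfPlane] with p hp
    have hp' : 0 < p.1 := hp.1
    have h := norm_superposition_le hω hC hp'
    have hs := pow_le_pow_left₀ (norm_nonneg _) h 2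
    rw [Real.norm_of_nonneg (by positivity)]
    have h2 : (1 + p.2 ^ 2) ≤ (1 + |p.2|) ^ 2 := by
      nlinarith [sq_abs p.2, abs_nonneg p.2]
    have h3 : Real.exp (-(2 * ω.re) * p.1) = Real.exp (-(ω.re * p.1)) ^ 2 := by
      rw [← Real.exp_nat_mul]; congr 1; push_cast; ring
    have h4 : √(Real.pi / (2 * (ω.re * p.1))) ^ 2 = Real.pi / (2 * (ω.re * p.1)) :=
      Real.sq_sqrt (by positivity)
    calc p.1 * ‖superposition ω F p‖ ^ 2 ≤ p.1 * (C * (2 * Real.exp (-(ω.re * p.1)) *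
          √(Real.pi / (2 * (ω.re * p.1)))) / (1 + |p.2|)) ^ 2 := by gcongr
      _ = C ^ 2 * (2 * Real.pi / ω.re) * Real.exp (-(2 * ω.re) * p.1) *
          ((1 + |p.2|) ^ 2)⁻¹ := by
        rw [div_pow, mul_pow, mul_pow, h4, h3]
        field_simp
      _ ≤ _ := by gcongr

/-! ### Quotients of `cosh (z / 2)` by products of linear factors -/

/-- The zeros `(2 j + 1) π i` of `cosh (z / 2)`. -/
noncomputable def coshZero (j : ℕ) : ℂ := ((2 * j + 1 : ℝ) * Real.pi : ℝ) * Complex.I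

/-- The entire function `cosh (z / 2) / ∏ i < j, (z - (2 i + 1) π i)`. -/
noncomputable def coshQuotient : ℕ → ℂ → ℂ
  | 0 => fun z => Complex.cosh (z / 2)
  | j + 1 => dslope (coshQuotient j) (coshZero j)

theorem coshZero_sub_ne_zero {i j : ℕ} (h : i < j) : coshZero j - coshZero i ≠ 0 := by
  rw [coshZero, coshZero, ← sub_mul, ← Complex.ofReal_sub, ← sub_mul]
  refine mul_ne_zero (Complex.ofReal_ne_zero.2 (mul_ne_zero ?_ Real.pi_ne_zero)) Complex.I_ne_zero
  have : (i : ℝ) < j := by exact_mod_cast h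
  linarith

theorem cosh_coshZero_half (j : ℕ) : Complex.cosh (coshZero j / 2) = 0 := by
  rw [coshZero, mul_div_right_comm, Complex.cosh_mul_I, Complex.cos_eq_zero_iff]
  exact ⟨j, by push_cast; ring⟩

theorem prod_mul_coshQuotient (j : ℕ) (z : ℂ) :
    (∏ i ∈ Finset.range j, (z - coshZero i)) * coshQuotient j z = Complex.cosh (z / 2) := by
  induction j generalizing z with
  | zero => simp [coshQuotient]
  | succ j ih =>
    have hz : coshQuotient j (coshZero j) = 0 := by
      refine (mul_eq_zero.1 ((ih (coshZero j)).trans (cosh_coshZero_half j))).resolve_left ?_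
      exact Finset.prod_ne_zero_iff.2 fun i hi => coshZero_sub_ne_zero (Finset.mem_range.1 hi)
    have h := sub_smul_dslope (coshQuotient j) (coshZero j) z
    rw [hz, sub_zero, smul_eq_mul] at h
    rw [Finset.prod_range_succ, mul_assoc, coshQuotient, h, ih]

theorem coshQuotient_coshZero (j : ℕ) : coshQuotient j (coshZero j) = 0 := by
  refine (mul_eq_zero.1 ((prod_mul_coshQuotient j (coshZero j)).trans
    (cosh_coshZero_half j))).resolve_left ?_
  exact Finset.prod_ne_zero_iff.2 fun i hi => coshZero_sub_ne_zero (Finset.mem_range.1 hi)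

theorem norm_cosh_le (z : ℂ) : ‖Complex.cosh z‖ ≤ Real.cosh z.re := by
  rw [Complex.cosh, Real.cosh_eq, norm_div, Complex.norm_two]
  gcongr
  exact (norm_add_le _ _).trans_eq (by rw [Complex.norm_exp, Complex.norm_exp, Complex.neg_re])

/-- Dividing by a zero improves the growth by a factor `1 / (1 + |Im z|)`. -/
theorem HalfGrowth.exists_norm_dslope_le {F : ℂ → ℂ} (hF : HalfGrowth F) {a : ℂ} (ha : F a = 0) :
    Differentiable ℂ (dslope F a) ∧ ∃ C, 0 ≤ C ∧
      ∀ z, ‖dslope F a z‖ * (1 + |z.im|) ≤ C * Real.cosh (z.re / 2) := by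
  obtain ⟨hd, C, hC, hle⟩ := hF
  have hd' : Differentiable ℂ (dslope F a) :=
    differentiableOn_univ.1 <| (Complex.differentiableOn_dslope Filter.univ_mem).2
      hd.differentiableOn
  have hcont : Continuous fun z => ‖dslope F a z‖ * (1 + |z.im|) :=
    hd'.continuous.norm.mul (continuous_const.add Complex.continuous_im.abs)
  obtain ⟨B, hB⟩ := (isCompact_closedBall a 1).exists_bound_of_continuousOn hcont.continuousOn
  refine ⟨hd', max B (C * (2 + |a.im|)), le_max_of_le_right (by positivity), fun z => ?_⟩
  by_cases hz : ‖z - a‖ ≤ 1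
  · have h := (Real.le_norm_self _).trans (hB z (mem_closedBall_iff_norm.2 hz))
    have h1 := Real.one_le_cosh (z.re / 2)
    have h0 : 0 ≤ max B (C * (2 + |a.im|)) := le_max_of_le_right (by positivity)
    exact (h.trans (le_max_left _ _)).trans (le_mul_of_one_le_right h0 h1)
  · rw [not_le] at hz
    have hpos : 0 < ‖z - a‖ := one_pos.trans hz
    have hmul : ‖z - a‖ * ‖dslope F a z‖ = ‖F z‖ := by
      have h := sub_smul_dslope F a z
      rw [ha, sub_zero] at h
      rw [← h, norm_smul]
    have him : |z.im| ≤ |a.im| + ‖z - a‖ := by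
      have h1 := Complex.abs_im_le_norm (z - a)
      have h2 := abs_add_le a.im (z - a).im
      rw [Complex.sub_im] at h1 h2
      rw [add_sub_cancel] at h2
      linarith
    have h3 : 1 + |z.im| ≤ ‖z - a‖ * (2 + |a.im|) := by
      nlinarith [mul_nonneg (abs_nonneg a.im) (sub_nonneg.2 hz.le)]
    calc _ ≤ ‖dslope F a z‖ * (‖z - a‖ * (2 + |a.im|)) := by gcongr
      _ = ‖F z‖ * (2 + |a.im|) := by rw [← hmul]; ring
      _ ≤ C * Real.cosh (z.re / 2) * (2 + |a.im|) := by gcongr; exact hle z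
      _ = C * (2 + |a.im|) * Real.cosh (z.re / 2) := by ring
      _ ≤ _ := by
        gcongr
        exact le_max_right _ _

theorem halfGrowth_coshQuotient (j : ℕ) : HalfGrowth (coshQuotient j) := by
  induction j with
  | zero =>
    refine ⟨Complex.differentiable_cosh.comp (differentiable_id.div_const 2), 1, one_pos.le,
      fun z => ?_⟩
    have h := norm_cosh_le (z / 2)
    simpa [coshQuotient] using h
  | succ j ih =>
    obtain ⟨hd, C, hC, h⟩ := ih.exists_norm_dslope_le (coshQuotient_coshZero j)
    refine ⟨hd, C, hC, fun z => le_trans ?_ (h z)⟩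
    exact le_mul_of_one_le_right (norm_nonneg _) (le_add_of_nonneg_right (abs_nonneg _))

theorem exists_norm_coshQuotient_succ_le (j : ℕ) :
    ∃ C, ∀ z, ‖coshQuotient (j + 1) z‖ * (1 + |z.im|) ≤ C * Real.cosh (z.re / 2) :=
  let ⟨C, _, h⟩ := ((halfGrowth_coshQuotient j).exists_norm_dslope_le (coshQuotient_coshZero j)).2
  ⟨C, h⟩

/-! ### Linear independence of the superpositions -/

open Filter Topology

theorem coshQuotient_sub_mul (j m : ℕ) (t : ℝ) :
    (m : ℂ) ^ j * ((-1) ^ m * coshQuotient j (t + (-(2 * Real.pi * m) : ℝ) * Complex.I)) =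
      (∏ i ∈ Finset.range j, (m : ℂ) / (t - ((2 * m + 2 * i + 1) * Real.pi : ℝ) * Complex.I)) *
        (Real.cosh (t / 2) : ℝ) := by
  have h := prod_mul_coshQuotient j (t + (-(2 * Real.pi * m) : ℝ) * Complex.I)
  have hf (i : ℕ) : (t + (-(2 * Real.pi * m) : ℝ) * Complex.I) - coshZero i =
      t - ((2 * m + 2 * i + 1) * Real.pi : ℝ) * Complex.I := by
    rw [coshZero]; push_cast; ring
  have hne (i : ℕ) : (t : ℂ) - ((2 * m + 2 * i + 1) * Real.pi : ℝ) * Complex.I ≠ 0 := by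
    intro h0
    have h1 := congrArg Complex.im h0
    have h2 : 0 < (2 * (m : ℝ) + 2 * i + 1) * Real.pi := by positivity
    simp [-mul_eq_zero] at h1
    linarith
  have hc : Complex.cosh ((t + (-(2 * Real.pi * m) : ℝ) * Complex.I) / 2) =
      (-1) ^ m * (Real.cosh (t / 2) : ℝ) := by
    have h1 := Complex.cosh_antiperiodic.sub_nat_mul_eq (x := (t / 2 : ℂ)) m
    push_cast
    rw [← h1]
    congr 1
    ring
  simp only [hf] at h
  rw [hc] at h
  rw [Finset.prod_div_distrib, Finset.prod_const, Finset.card_range, div_mul_eq_mul_div,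
    eq_div_iff (Finset.prod_ne_zero_iff.2 fun i _ => hne i)]
  have hs : ((-1 : ℂ) ^ m) * (-1) ^ m = 1 := by rw [← mul_pow]; simp
  linear_combination ((m : ℂ) ^ j * (-1) ^ m) * h + (m : ℂ) ^ j * (Real.cosh (t / 2) : ℝ) * hs

theorem tendsto_natCast_div (i : ℕ) (t : ℝ) :
    Tendsto (fun m : ℕ => (m : ℂ) / (t - ((2 * m + 2 * i + 1) * Real.pi : ℝ) * Complex.I)) atTop
      (𝓝 (-(2 * Real.pi * Complex.I))⁻¹) := by
  have hne : -(2 * Real.pi * Complex.I) ≠ 0 := by simp [Real.pi_ne_zero]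
  have h1 : Tendsto (fun m : ℕ => ((t : ℂ) - (2 * i + 1) * Real.pi * Complex.I) / (m : ℂ)) atTop
      (𝓝 0) := tendsto_const_div_atTop_nhds_zero_nat _
  have h2 := (h1.add_const (-(2 * Real.pi * Complex.I))).inv₀ (by rwa [zero_add])
  rw [zero_add] at h2
  refine h2.congr' ?_
  filter_upwards [eventually_ne_atTop 0] with m hm
  have hm' : (m : ℂ) ≠ 0 := by exact_mod_cast hm
  rw [← inv_div]
  field_simp
  push_cast
  ring

theorem norm_natCast_div_le (i m : ℕ) (t : ℝ) :
    ‖(m : ℂ) / (t - ((2 * m + 2 * i + 1) * Real.pi : ℝ) * Complex.I)‖ ≤ 1 := by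
  rw [norm_div, Complex.norm_natCast]
  refine div_le_one_of_le₀ ?_ (norm_nonneg _)
  refine le_trans ?_ (Complex.abs_im_le_norm _)
  have h2 : 0 < (2 * (m : ℝ) + 2 * i + 1) * Real.pi := by positivity
  rw [Complex.sub_im, Complex.ofReal_im, zero_sub, Complex.im_ofReal_mul, Complex.I_im, mul_one,
    abs_neg, abs_of_pos h2]
  nlinarith [Real.pi_gt_three, (Nat.cast_nonneg m : (0 : ℝ) ≤ m), (Nat.cast_nonneg i : (0 : ℝ) ≤ i)]

/-- Asymptotics of the superpositions along `θ = -2 π m`, `r = 1`. -/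
theorem tendsto_superposition_coshQuotient {ω : ℂ} (hω : 0 < ω.re) (j : ℕ) :
    Tendsto (fun m : ℕ => (m : ℂ) ^ j *
        ((-1) ^ m * superposition ω (coshQuotient j) (1, -(2 * Real.pi * m)))) atTop
      (𝓝 ((-(2 * Real.pi * Complex.I))⁻¹ ^ j *
        (2 * Complex.exp (-ω) * ((Real.pi : ℂ) / (2 * ω)) ^ (1 / 2 : ℂ)))) := by
  have hk := kernel_integral hω
  rw [← hk.2, ← integral_const_mul]
  simp only [superposition, ← integral_const_mul]
  have he (m : ℕ) (t : ℝ) : (m : ℂ) ^ j *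
      ((-1) ^ m * wave ω (coshQuotient j) t (1, -(2 * Real.pi * m))) =
      (∏ i ∈ Finset.range j, (m : ℂ) / (t - ((2 * m + 2 * i + 1) * Real.pi : ℝ) * Complex.I)) *
        (Complex.exp (-(ω * (Real.cosh t : ℝ))) * (Real.cosh (t / 2) : ℝ)) := by
    rw [wave, Complex.ofReal_one, mul_one]
    linear_combination Complex.exp (-(ω * (Real.cosh t : ℝ))) * coshQuotient_sub_mul j m t
  refine tendsto_integral_of_dominated_convergence _ (fun m => ?_) hk.1.norm
    (fun m => .of_forall fun t => ?_) (.of_forall fun t => ?_)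
  · have := continuous_wave_left ω (halfGrowth_coshQuotient j).1.continuous
      (1, -(2 * Real.pi * m))
    exact (continuous_const.mul (continuous_const.mul this)).aestronglyMeasurable
  · rw [he, norm_mul, norm_prod]
    exact mul_le_of_le_one_left (norm_nonneg _)
      (Finset.prod_le_one (fun _ _ => norm_nonneg _) fun i _ => norm_natCast_div_le i m t)
  · simp only [he]
    refine Tendsto.mul_const _ ?_
    have h := tendsto_finsetProd (Finset.range j) fun i _ => tendsto_natCast_div i t
    simpa using h

/-- Sequences decaying at different polynomial rates are linearly independent. -/
theorem eq_zero_of_sum_eq_zero_of_tendsto {n : ℕ} {s : Fin n → ℕ → ℂ} {ℓ : Fin n → ℂ}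
    (hℓ : ∀ i, ℓ i ≠ 0)
    (hs : ∀ i : Fin n, Tendsto (fun m : ℕ => (m : ℂ) ^ (i + 1 : ℕ) * s i m) atTop (𝓝 (ℓ i)))
    {a : Fin n → ℂ} (ha : ∀ m, ∑ i, a i * s i m = 0) (i : Fin n) : a i = 0 := by
  induction i using WellFoundedLT.induction with
  | ind i ih =>
  have hlim (k : Fin n) : Tendsto (fun m : ℕ => a k * ((m : ℂ) ^ (i + 1 : ℕ) * s k m)) atTop
      (𝓝 (if k = i then a i * ℓ i else 0)) := by
    obtain hk | rfl | hk := lt_trichotomy k i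
    · simp [ih k hk, hk.ne]
    · simpa using (hs k).const_mul (a k)
    · rw [if_neg hk.ne']
      have hpos : (k - i : ℕ) ≠ 0 := (Nat.sub_pos_of_lt hk).ne'
      have h0 : Tendsto (fun m : ℕ => ((m : ℂ)⁻¹) ^ (k - i : ℕ)) atTop (𝓝 0) := by
        have := (tendsto_inv_atTop_nhds_zero_nat (𝕜 := ℂ)).pow (k - i : ℕ)
        rwa [zero_pow hpos] at this
      have h1 := ((h0.mul (hs k)).const_mul (a k))
      rw [zero_mul, mul_zero] at h1
      refine h1.congr' ?_
      filter_upwards [eventually_ne_atTop 0] with m hm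
      have hm' : (m : ℂ) ≠ 0 := by exact_mod_cast hm
      have hsplit : (k + 1 : ℕ) = (k - i : ℕ) + (i + 1) := by omega
      have hinv : ((m : ℂ)⁻¹) ^ (k - i : ℕ) * (m : ℂ) ^ (k - i : ℕ) = 1 := by
        rw [← mul_pow, inv_mul_cancel₀ hm', one_pow]
      rw [hsplit, pow_add]
      linear_combination (a k * (m : ℂ) ^ (i + 1 : ℕ) * s k m) * hinv
  have hsum := tendsto_finsetSum Finset.univ fun k _ => hlim k
  have hzero (m : ℕ) : ∑ k, a k * ((m : ℂ) ^ (i + 1 : ℕ) * s k m) = 0 := by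
    simp_rw [mul_left_comm (a _), ← Finset.mul_sum, ha, mul_zero]
  simp only [hzero, Finset.sum_ite_eq', Finset.mem_univ, if_true] at hsum
  exact (mul_eq_zero.1 (tendsto_nhds_unique tendsto_const_nhds hsum).symm).resolve_right (hℓ i)

theorem exists_linearIndependent_isDistribEigen {ω c : ℂ} (hω : 0 < ω.re)
    (hc : ω ^ 2 = starRingEnd ℂ c) (n : ℕ) :
    ∃ ψ : Fin n → Lp ℂ 2 polarMeasure,
      (∀ i, IsDistribEigen c (ψ i)) ∧ LinearIndependent ℂ ψ := by
  have hmem (j : ℕ) : MemLp (superposition ω (coshQuotient (j + 1))) 2 polarMeasure :=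
    let ⟨_, h⟩ := exists_norm_coshQuotient_succ_le j
    memLp_superposition hω (halfGrowth_coshQuotient _) h
  refine ⟨fun i => (hmem i).toLp _, fun i => isDistribEigen_of_superposition hω hc
    (halfGrowth_coshQuotient _) (hmem i).coeFn_toLp, Fintype.linearIndependent_iff.2 ?_⟩
  intro a ha
  have hae : ∀ᵐ p ∂polarMeasure,
      ∑ i : Fin n, a i * superposition ω (coshQuotient (i + 1)) p = 0 := by
    have h1 : ∀ᵐ p ∂polarMeasure, ∀ i : Fin n, (a i • (hmem i).toLp _ : Lp ℂ 2 polarMeasure) p =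
        a i * superposition ω (coshQuotient (i + 1)) p := by
      refine ae_all_iff.2 fun i => ?_
      filter_upwards [Lp.coeFn_smul (a i) ((hmem i).toLp _), (hmem i).coeFn_toLp] with p h h'
      rw [h, Pi.smul_apply, h', smul_eq_mul]
    have h2 := Lp.coeFn_fun_finsetSum Finset.univ
      fun i : Fin n => (a i • (hmem i).toLp _ : Lp ℂ 2 polarMeasure)
    rw [ha] at h2
    filter_upwards [h1, h2, Lp.coeFn_zero ℂ 2 polarMeasure] with p hp hp' h0
    rw [← Finset.sum_congr rfl fun i _ => hp i, ← hp', h0, Pi.zero_apply]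
  have hcont : ContinuousOn
      (fun p => ∑ i : Fin n, a i * superposition ω (coshQuotient (i + 1)) p)
      (Ioi (0 : ℝ) ×ˢ univ) :=
    continuousOn_finsetSum _ fun i _ => continuousOn_const.mul
      (continuousOn_superposition hω (halfGrowth_coshQuotient _))
  refine eq_zero_of_sum_eq_zero_of_tendsto
    (s := fun i m => (-1) ^ m * superposition ω (coshQuotient (i + 1)) (1, -(2 * Real.pi * m)))
    (fun i => ?_) (fun i => tendsto_superposition_coshQuotient hω (i + 1)) fun m => ?_
  · have hω0 : ω ≠ 0 := fun h => by simp [h] at hω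
    have h1 : ((Real.pi : ℂ) / (2 * ω)) ^ (1 / 2 : ℂ) ≠ 0 := by
      simp [Complex.cpow_eq_zero_iff, hω0, Real.pi_ne_zero]
    refine mul_ne_zero (pow_ne_zero _ (inv_ne_zero ?_))
      (mul_ne_zero (mul_ne_zero two_ne_zero (Complex.exp_ne_zero _)) h1)
    simp [Real.pi_ne_zero]
  · simp_rw [mul_left_comm (a _), ← Finset.mul_sum]
    rw [eq_zero_of_ae_polarMeasure hcont hae one_pos, mul_zero]

/-! ### Failure of essential selfadjointness -/

/-- A densely defined operator is not essentially selfadjoint as soon as its adjoint has a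
nonreal eigenvalue. -/
theorem LinearPMap.adjoint_ne_closure_of_inner_eq {E : Type*} [NormedAddCommGroup E]
    [InnerProductSpace ℂ E] [CompleteSpace E] {T : E →ₗ.[ℂ] E} (hT : Dense (T.domain : Set E))
    {ψ : E} (hψ : ψ ≠ 0) {c : ℂ} (hc : starRingEnd ℂ c ≠ c)
    (h : ∀ x : T.domain, inner ℂ ψ (T x) = c * inner ℂ ψ (x : E)) :
    T.adjoint ≠ T.closure := by
  intro heq
  have h' (x : T.domain) : inner ℂ (starRingEnd ℂ c • ψ) (x : E) = inner ℂ ψ (T x) := by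
    rw [inner_smul_left, Complex.conj_conj, h]
  have hmem : ψ ∈ T.adjoint.domain := mem_adjoint_domain_of_exists ψ ⟨_, h'⟩
  have happ : T.adjoint ⟨ψ, hmem⟩ = starRingEnd ℂ c • ψ := adjoint_apply_eq hT _ h'
  have hgraph : (ψ, starRingEnd ℂ c • ψ) ∈ T.closure.graph :=
    heq ▸ happ ▸ T.adjoint.mem_graph ⟨ψ, hmem⟩
  have hle : T.closure.graph ≤ T.graph.topologicalClosure := by
    by_cases hcl : T.IsClosable
    · exact hcl.graph_closure_eq_closure_graph.ge
    · rw [closure_def' hcl]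
      exact T.graph.le_topologicalClosure
  have hclosed : _root_.IsClosed
      {q : E × E | inner ℂ (starRingEnd ℂ c • ψ) q.1 = inner ℂ ψ q.2} :=
    isClosed_eq (continuous_const.inner continuous_fst) (continuous_const.inner continuous_snd)
  have hsub : (T.graph : Set (E × E)) ⊆
      {q : E × E | inner ℂ (starRingEnd ℂ c • ψ) q.1 = inner ℂ ψ q.2} := by
    rintro q hq
    obtain ⟨x, hx⟩ := (T.mem_graph_iff).1 hq
    rw [mem_ofPred_eq, ← hx.1, ← hx.2, h']
  have hfix : inner ℂ (starRingEnd ℂ c • ψ) ψ = inner ℂ ψ (starRingEnd ℂ c • ψ) :=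
    closure_minimal hsub hclosed (hle hgraph)
  rw [inner_smul_left, inner_smul_right, Complex.conj_conj] at hfix
  exact hc (mul_right_cancel₀ (inner_self_ne_zero.2 hψ) hfix).symm

theorem L2_inner_eq_integral (f g : Lp ℂ 2 polarMeasure) :
    inner ℂ f g = ∫ p, g p * starRingEnd ℂ (f p) ∂polarMeasure := by
  rw [L2.inner_def]
  rfl

/-- Test functions are dense in `L²(ℝ₊ × ℝ, r dr dθ)`. -/
theorem dense_of_mem_iff_isLogTest {D : Submodule ℂ (Lp ℂ 2 polarMeasure)}
    (hD : ∀ f, IsLogTest f → ∀ F : Lp ℂ 2 polarMeasure, F =ᵐ[polarMeasure] f → F ∈ D) :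
    Dense (D : Set (Lp ℂ 2 polarMeasure)) := by
  rw [Submodule.dense_iff_topologicalClosure_eq_top, Submodule.topologicalClosure_eq_top_iff,
    Submodule.eq_bot_iff]
  intro ψ hψ
  have hloc : LocallyIntegrableOn ψ (Ioi (0 : ℝ) ×ˢ univ) polarMeasure :=
    ((Lp.memLp ψ).locallyIntegrable one_le_two).locallyIntegrableOn _
  have hzero := isOpen_halfPlane.ae_eq_zero_of_integral_contDiff_smul_eq_zero hloc
    fun g hg hc hs => by
      have hf : IsLogTest fun p => (g p : ℂ) := by
        have hsub : tsupport (fun p => (g p : ℂ)) ⊆ tsupport g :=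
          closure_mono fun p hp h => hp (by simp [h])
        exact ⟨Complex.ofRealCLM.contDiff.comp hg, hc.comp_left Complex.ofReal_zero, hsub.trans hs⟩
      have hin := (Submodule.mem_orthogonal _ _).1 hψ _
        (hD _ hf (hf.memLp.toLp _) hf.memLp.coeFn_toLp)
      rw [L2_inner_eq_integral] at hin
      rw [← hin]
      refine integral_congr_ae ?_
      filter_upwards [hf.memLp.coeFn_toLp] with p hp
      rw [hp, Complex.conj_ofReal, Complex.real_smul, mul_comm]
  refine (Lp.eq_zero_iff_ae_eq_zero).2 ?_
  filter_upwards [hzero, ae_polarMeasure_pos] with p hp hpos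
  exact hp ⟨hpos, mem_univ _⟩

theorem IsDistribEigen.inner_eq {c : ℂ} {ψ : Lp ℂ 2 polarMeasure} (hψ : IsDistribEigen c ψ)
    {f : ℝ × ℝ → ℂ} (hf : IsLogTest f) {F G : Lp ℂ 2 polarMeasure} (hF : F =ᵐ[polarMeasure] f)
    (hG : G =ᵐ[polarMeasure] polarLap f) : inner ℂ ψ G = c * inner ℂ ψ F := by
  have h0 : inner ℂ (G - c • F) ψ = 0 := by
    rw [L2_inner_eq_integral, ← hψ f hf]
    refine integral_congr_ae ?_
    filter_upwards [hF, hG, Lp.coeFn_sub G (c • F), Lp.coeFn_smul c F] with p h₁ h₂ h₃ h₄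
    rw [h₃, Pi.sub_apply, h₄, Pi.smul_apply, h₁, h₂, smul_eq_mul]
  rw [inner_eq_zero_symm, inner_sub_right, inner_smul_right] at h0
  exact sub_eq_zero.1 h0

/-- The space `{ψ ∈ L²(ℝ₊ × ℝ, r dr dθ) : Δψ = ψ distributionally}` is
infinite dimensional.  Consequently the Laplacian `Δ` with domain `C_c^∞(ℝ₊ × ℝ)` (any
unbounded operator `T` with that domain and action) is not essentially selfadjoint, and
its deficiency spaces at `±i` are both infinite dimensional, i.e. it has deficiency
indices `(∞, ∞)`. -/
theorem stmt6 (T : Lp ℂ 2 polarMeasure →ₗ.[ℂ] Lp ℂ 2 polarMeasure)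
    (hdom : ∀ F : Lp ℂ 2 polarMeasure,
      F ∈ T.domain ↔ ∃ f, IsLogTest f ∧ ⇑F =ᵐ[polarMeasure] f)
    (hact : ∀ (v : T.domain) (f : ℝ × ℝ → ℂ), IsLogTest f →
      ⇑(v : Lp ℂ 2 polarMeasure) =ᵐ[polarMeasure] f → ⇑(T v) =ᵐ[polarMeasure] polarLap f) :
    (∀ n : ℕ, ∃ ψ : Fin n → Lp ℂ 2 polarMeasure,
      (∀ i, IsDistribEigen 1 (ψ i)) ∧ LinearIndependent ℂ ψ) ∧
    T.adjoint ≠ T.closure ∧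
    (∀ c : ℂ, c = Complex.I ∨ c = -Complex.I →
      ∀ n : ℕ, ∃ ψ : Fin n → Lp ℂ 2 polarMeasure,
        (∀ i, IsDistribEigen c (ψ i)) ∧ LinearIndependent ℂ ψ) := by
  have hsq : ((√2 : ℝ) : ℂ) ^ 2 = 2 := by exact_mod_cast Real.sq_sqrt zero_le_two
  have hI (c : ℂ) (hc : c = Complex.I ∨ c = -Complex.I) (n : ℕ) :
      ∃ ψ : Fin n → Lp ℂ 2 polarMeasure,
        (∀ i, IsDistribEigen c (ψ i)) ∧ LinearIndependent ℂ ψ := by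
    refine exists_linearIndependent_isDistribEigen (ω := (√2 / 2 : ℝ) * (1 - c)) ?_ ?_ n
    · obtain rfl | rfl := hc <;> simp
    · have hc2 : c ^ 2 = -1 := by obtain rfl | rfl := hc <;> simp
      have hconj : starRingEnd ℂ c = -c := by obtain rfl | rfl := hc <;> simp
      rw [hconj]
      push_cast
      linear_combination (1 - c) ^ 2 / 4 * hsq + (1 / 2 : ℂ) * hc2
  refine ⟨exists_linearIndependent_isDistribEigen (ω := 1) (by simp) (by simp), ?_, hI⟩
  obtain ⟨ψ, hψ, hli⟩ := hI Complex.I (.inl rfl) 1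
  refine LinearPMap.adjoint_ne_closure_of_inner_eq (c := Complex.I)
    (dense_of_mem_iff_isLogTest fun f hf F hF => (hdom F).2 ⟨f, hf, hF⟩) (hli.ne_zero 0) ?_
    fun x => ?_
  · rw [Complex.conj_I]
    exact fun h => Complex.I_ne_zero (self_eq_neg.1 h.symm)
  · obtain ⟨f, hf, hx⟩ := (hdom x).1 x.2
    exact (hψ 0).inner_eq hf hx (hact x f hf hx)
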